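/- Let k, m be positive integers and let H be a graph on n = km vertices with minimum degree δ(H) ≥ n(1 − 1/m). Then V(H) can be partitioned into k sets, each of size m, each of which induces a complete subgraph (clique) of H. -/

import Mathlib

namespace HajnalSzemeredi

open scoped Classical
open Finset Relation

noncomputable section

variable {V κ : Type*}

/-! ### Reachability inside a finite set -/

/-- `a` is reachable from `c` along `R`-steps that stay inside `P`. -/
def ReachIn (R : κ → κ → Prop) (P : Finset κ) (c a : κ) : Prop :=
  ReflTransGen (fun x y => R x y ∧ x ∈ P ∧ y ∈ P) c a

lemma ReachIn.head {R : κ → κ → Prop} {P : Finset κ} {c d a : κ} (hR : R c d) (hc : c ∈ P)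
    (hd : d ∈ P) (h : ReachIn R P d a) : ReachIn R P c a :=
  ReflTransGen.head ⟨hR, hc, hd⟩ h

lemma ReachIn.mem {R : κ → κ → Prop} {P : Finset κ} {c a : κ} (h : ReachIn R P c a)
    (ha : a ∈ P) : c ∈ P := by
  rcases ReflTransGen.cases_head h with rfl | ⟨d, hd, -⟩
  exacts [ha, hd.2.1]

/-- A path to `a ≠ c` either avoids `c` or contains a step from `c` after which it avoids `c`. -/
lemma ReachIn.avoid_or_step {R : κ → κ → Prop} {P : Finset κ} {x a c : κ} (h : ReachIn R P x a)
    (ha : a ∈ P) (hca : c ≠ a) :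
    ReachIn R (P.erase c) x a ∨ ∃ d ∈ P.erase c, R c d ∧ ReachIn R (P.erase c) d a := by
  have ha' : a ∈ P.erase c := mem_erase.2 ⟨hca.symm, ha⟩
  induction h using ReflTransGen.head_induction_on with
  | refl => exact .inl .refl
  | @head x y hxy _ ih =>
    rcases ih with ih | ih
    · have hy := ReachIn.mem ih ha'
      by_cases hx : x = c
      · subst hx
        exact .inr ⟨y, hy, hxy.1, ih⟩
      · exact .inl (ih.head hxy.1 (mem_erase.2 ⟨hx, hxy.2.1⟩) hy)
    · exact .inr ih

lemma ReachIn.exists_step {R : κ → κ → Prop} {P : Finset κ} {a c : κ} (h : ReachIn R P c a)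
    (ha : a ∈ P) (hca : c ≠ a) :
    ∃ d ∈ P.erase c, R c d ∧ ReachIn R (P.erase c) d a := by
  rcases h.avoid_or_step ha hca with h | h
  · exact absurd (h.mem (mem_erase.2 ⟨hca.symm, ha⟩)) (notMem_erase _ _)
  · exact h

/-- In a finite digraph in which every vertex reaches `a`, some nonempty set `T` of vertices can be
left only through a single vertex `u`, and no vertex of `T` is needed by the others to reach `a`. -/
lemma exists_terminal_family {R : κ → κ → Prop} {A : Finset κ} {a : κ} (ha : a ∈ A)
    (hA : ∀ c ∈ A, ReachIn R A c a) (hne : ∃ c ∈ A, c ≠ a) :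
    ∃ u ∈ A, ∃ T ⊆ A, T.Nonempty ∧ a ∉ T ∧ u ∉ T ∧
      (∀ x ∈ T, ∀ y ∈ A, R x y → y = u ∨ y ∈ T) ∧
      ∀ w ∈ T, ∀ c ∈ A, c ≠ w → ReachIn R (A.erase w) c a := by
  let T : κ → Finset κ := fun u => A.filter fun c => c ≠ u ∧ ¬ ReachIn R (A.erase u) c a
  have memT : ∀ u c, c ∈ T u ↔ c ∈ A ∧ c ≠ u ∧ ¬ ReachIn R (A.erase u) c a := by
    intro u c
    simp [T]
  have hTa : (T a).Nonempty := by
    obtain ⟨c, hc, hca⟩ := hne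
    refine ⟨c, (memT _ _).2 ⟨hc, hca, fun h => ?_⟩⟩
    rcases ReflTransGen.cases_tail h with h | ⟨d, -, hd⟩
    · exact hca h.symm
    · exact notMem_erase _ _ hd.2.2
  obtain ⟨u, hu, hmin⟩ := exists_min_image (A.filter fun u => (T u).Nonempty) (fun u => (T u).card)
    ⟨a, mem_filter.2 ⟨ha, hTa⟩⟩
  rw [mem_filter] at hu
  have haT : a ∉ T u := fun h => ((memT _ _).1 h).2.2 .refl
  refine ⟨u, hu.1, T u, filter_subset _ _, hu.2, haT, fun h => ((memT _ _).1 h).2.1 rfl, ?_, ?_⟩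
  · intro x hx y hy hxy
    by_contra! hcon
    obtain ⟨hxA, hxu, hx⟩ := (memT _ _).1 hx
    have hyr : ReachIn R (A.erase u) y a := by
      by_contra h
      exact hcon.2 ((memT _ _).2 ⟨hy, hcon.1, h⟩)
    exact hx (hyr.head hxy (mem_erase.2 ⟨hxu, hxA⟩) (mem_erase.2 ⟨hcon.1, hy⟩))
  · intro w hw
    obtain ⟨hwA, hwu, hwr⟩ := (memT _ _).1 hw
    have haw : a ≠ w := fun h => haT (h ▸ hw)
    have avoid : ∀ c, ReachIn R (A.erase u) c a → ReachIn R (A.erase w) c a := by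
      intro c hc
      induction hc using ReflTransGen.head_induction_on with
      | refl => exact .refl
      | @head x y hxy hy ih =>
        have hxw : x ≠ w := by
          rintro rfl
          exact hwr (ReflTransGen.head hxy hy)
        have hyw : y ≠ w := by
          rintro rfl
          exact hwr hy
        exact ih.head hxy.1 (mem_erase.2 ⟨hxw, mem_of_mem_erase hxy.2.1⟩)
          (mem_erase.2 ⟨hyw, mem_of_mem_erase hxy.2.2⟩)
    have hsub : T w ⊆ (T u).erase w := by
      intro c hc
      obtain ⟨hcA, hcw, hcr⟩ := (memT _ _).1 hc
      refine mem_erase.2 ⟨hcw, (memT _ _).2 ⟨hcA, ?_, fun h => hcr (avoid c h)⟩⟩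
      rintro rfl
      by_cases hca : c = a
      · exact hcr (hca ▸ .refl)
      · obtain ⟨d, hd, hcd, hda⟩ := (hA c hcA).exists_step ha hca
        have := avoid d hda
        exact hcr (this.head hcd (mem_erase.2 ⟨hcw, hcA⟩)
          (this.mem (mem_erase.2 ⟨haw, ha⟩)))
    intro c hcA hcw
    by_contra hcr
    have h1 := hmin w (mem_filter.2 ⟨hwA, c, (memT _ _).2 ⟨hcA, hcw, hcr⟩⟩)
    have h2 := card_le_card hsub
    have h3 := card_erase_lt_of_mem hw
    omega

/-! ### Colourings -/

/-- No edge of `G` inside `S` is monochromatic under `f`. -/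
def Proper (G : SimpleGraph V) (S : Finset V) (f : V → κ) : Prop :=
  ∀ v ∈ S, ∀ w ∈ S, G.Adj v w → f v ≠ f w

/-- The vertices of `S` that have colour `x`. -/
def colorClass (f : V → κ) (S : Finset V) (x : κ) : Finset V := S.filter fun v => f v = x

/-- The number of neighbours of `v` in `X`. -/
def degIn (G : SimpleGraph V) (v : V) (X : Finset V) : ℕ := (X.filter (G.Adj v)).card

/-- Some vertex of colour `c` has no neighbour of colour `d`. -/
def Movable (G : SimpleGraph V) (S : Finset V) (f : V → κ) (c d : κ) : Prop :=
  ∃ v ∈ S, f v = c ∧ ∀ w ∈ S, f w = d → ¬ G.Adj v w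

@[simp] lemma mem_colorClass {f : V → κ} {S : Finset V} {x : κ} {v : V} :
    v ∈ colorClass f S x ↔ v ∈ S ∧ f v = x := by
  simp [colorClass]

lemma card_colorClass_erase {f : V → κ} {S : Finset V} {v : V} (hv : v ∈ S) (x : κ) :
    (colorClass f (S.erase v) x).card + (if x = f v then 1 else 0) =
      (colorClass f S x).card := by
  have : colorClass f (S.erase v) x = (colorClass f S x).erase v := by
    ext w
    simp [and_assoc]
  rw [this]
  split_ifs with h
  · exact card_erase_add_one (by simp [hv, h])
  · rw [erase_eq_of_notMem (by simp [Ne.symm h]), add_zero]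

lemma card_colorClass_update {f : V → κ} {S : Finset V} {v : V} (hv : v ∈ S) (d x : κ) :
    (colorClass (Function.update f v d) S x).card =
      (colorClass f (S.erase v) x).card + (if x = d then 1 else 0) := by
  rw [← card_colorClass_erase hv x, Function.update_self]
  congr 2
  ext w
  by_cases h : w = v <;> simp [h]

lemma Proper.update {G : SimpleGraph V} {f : V → κ} {S : Finset V} {v : V} {d : κ}
    (hf : Proper G (S.erase v) f) (hv : ∀ w ∈ S, w ≠ v → f w = d → ¬ G.Adj v w) :
    Proper G S (Function.update f v d) := by
  intro x hx y hy hxy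
  by_cases hxv : x = v
  · subst hxv
    have hyx : y ≠ x := hxy.ne'
    rw [Function.update_self, Function.update_of_ne hyx]
    exact fun h => hv y hy hyx h.symm hxy
  · rw [Function.update_of_ne hxv]
    by_cases hyv : y = v
    · subst hyv
      rw [Function.update_self]
      exact fun h => hv x hx hxv h hxy.symm
    · rw [Function.update_of_ne hyv]
      exact hf x (mem_erase.2 ⟨hxv, hx⟩) y (mem_erase.2 ⟨hyv, hy⟩) hxy

lemma Proper.mono {G : SimpleGraph V} {f : V → κ} {S S' : Finset V} (hf : Proper G S f)
    (h : S' ⊆ S) : Proper G S' f :=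
  fun x hx y hy => hf x (h hx) y (h hy)

/-- Shifting one vertex along each step of a path from colour `c` to colour `a`. -/
lemma exists_shift {G : SimpleGraph V} {S : Finset V} {f : V → κ} (hf : Proper G S f) {a : κ}
    (P : Finset κ) (haP : a ∈ P) (c : κ) (hc : ReachIn (Movable G S f) P c a) :
    ∃ f' : V → κ, Proper G S f' ∧ (∀ v, f v ∉ P → f' v = f v) ∧
      (∀ v, f v ∈ P → f' v ∈ P) ∧ (∀ v, f' v = c → f v = c) ∧
      ∀ x, (colorClass f' S x).card + (if x = c then 1 else 0) =
        (colorClass f S x).card + (if x = a then 1 else 0) := by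
  induction P using Finset.strongInduction generalizing c with
  | H P ih =>
    by_cases hca : c = a
    · subst hca
      exact ⟨f, hf, fun _ _ => rfl, fun _ h => h, fun _ h => h, fun _ => rfl⟩
    have hcP := hc.mem haP
    obtain ⟨d, hd, ⟨v, hvS, hvc, hvd⟩, hda⟩ := hc.exists_step haP hca
    obtain ⟨f', hf', hout, hin, hdd, hcard⟩ := ih (P.erase c) (erase_ssubset hcP)
      (mem_erase.2 ⟨Ne.symm hca, haP⟩) d hda
    have hdc := ne_of_mem_erase hd
    have hf'v : f' v = c := by
      rw [← hvc]
      exact hout v (by simp [hvc])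
    refine ⟨Function.update f' v d, (hf'.mono (erase_subset _ _)).update ?_, ?_, ?_, ?_, ?_⟩
    · exact fun w hw _ hwd => hvd w hw (hdd w hwd)
    · intro w hw
      have : w ≠ v := by
        rintro rfl
        exact hw (hvc ▸ hcP)
      rw [Function.update_of_ne this]
      exact hout w (fun h => hw (mem_of_mem_erase h))
    · intro w hw
      by_cases hwv : w = v
      · subst hwv
        rw [Function.update_self]
        exact mem_of_mem_erase hd
      · rw [Function.update_of_ne hwv]
        by_cases hwc : f w = c
        · rw [hout w (by simp [hwc])]
          exact hw
        · exact mem_of_mem_erase (hin w (mem_erase.2 ⟨hwc, hw⟩))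
    · intro w hw
      by_cases hwv : w = v
      · exact hwv ▸ hvc
      · rw [Function.update_of_ne hwv] at hw
        by_contra hwc
        by_cases hwP : f w ∈ P
        · have := hin w (mem_erase.2 ⟨hwc, hwP⟩)
          simp [hw] at this
        · exact hwc ((hout w (fun h => hwP (mem_of_mem_erase h))) ▸ hw)
    · intro x
      have h1 := card_colorClass_update (f := f') hvS d x
      have h2 := card_colorClass_erase (f := f') hvS x
      have h3 := hcard x
      rw [hf'v] at h2
      omega

/-! ### Counting edges -/

lemma degIn_mono (G : SimpleGraph V) (v : V) {X Y : Finset V} (h : X ⊆ Y) :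
    degIn G v X ≤ degIn G v Y :=
  card_le_card (filter_subset_filter _ h)

lemma degIn_add_le (G : SimpleGraph V) (v : V) {X Y S : Finset V} (hX : X ⊆ S) (hY : Y ⊆ S)
    (h : Disjoint X Y) : degIn G v X + degIn G v Y ≤ degIn G v S := by
  rw [degIn, degIn, ← card_union_of_disjoint (disjoint_filter_filter h), ← filter_union]
  exact degIn_mono G v (union_subset hX hY)

lemma sum_degIn_comm (G : SimpleGraph V) (X Y : Finset V) :
    ∑ v ∈ X, degIn G v Y = ∑ w ∈ Y, degIn G w X := by
  simp only [degIn, card_filter]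
  rw [sum_comm]
  simp only [G.adj_comm]

/-- A vertex with a neighbour in every colour of `D` has at least `|D|` neighbours in those
colours. -/
lemma card_le_degIn (G : SimpleGraph V) {S : Finset V} {f : V → κ} {v : V} {D : Finset κ}
    (h : ∀ c ∈ D, ∃ w ∈ S, f w = c ∧ G.Adj v w) :
    D.card ≤ degIn G v (S.filter fun w => f w ∈ D) := by
  refine (card_le_card (t := ((S.filter fun w => f w ∈ D).filter (G.Adj v)).image f) ?_).trans
    card_image_le
  intro c hc
  obtain ⟨w, hw, rfl, hvw⟩ := h c hc
  exact mem_image_of_mem f (by simp [hw, hc, hvw])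

/-- A vertex with fewer than `|D|` neighbours has none in some colour of `D`. -/
lemma exists_color_of_degIn_lt (G : SimpleGraph V) {S : Finset V} {f : V → κ} {v : V}
    {D : Finset κ} (h : degIn G v S < D.card) :
    ∃ d ∈ D, ∀ w ∈ S, f w = d → ¬ G.Adj v w := by
  by_contra! hcon
  have := card_le_degIn G hcon
  exact absurd (this.trans (degIn_mono G v (filter_subset _ _))) (by omega)

lemma card_filter_mem_eq_sum (f : V → κ) (S : Finset V) (D : Finset κ) :
    (S.filter fun v => f v ∈ D).card = ∑ c ∈ D, (colorClass f S c).card := by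
  rw [card_eq_sum_card_fiberwise (f := f) (t := D) (fun v hv => by simpa using (mem_filter.1 hv).2)]
  refine sum_congr rfl fun c hc => ?_
  congr 1
  ext v
  simp only [mem_filter, mem_colorClass]
  constructor
  · rintro ⟨⟨h1, -⟩, h2⟩
    exact ⟨h1, h2⟩
  · rintro ⟨h1, h2⟩
    exact ⟨⟨h1, h2 ▸ hc⟩, h2⟩

lemma degIn_filter_mem_eq_sum (G : SimpleGraph V) (v : V) (f : V → κ) (S : Finset V)
    (D : Finset κ) :
    degIn G v (S.filter fun w => f w ∈ D) = ∑ c ∈ D, degIn G v (colorClass f S c) := by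
  have := card_filter_mem_eq_sum f (S.filter (G.Adj v)) D
  simp only [degIn, colorClass] at this ⊢
  rw [filter_comm, this]
  exact sum_congr rfl fun c _ => by rw [filter_comm]

/-- A maximal independent subset of `B` dominates `B`. -/
lemma exists_independent (G : SimpleGraph V) (B : Finset V) :
    ∃ I ⊆ B, (∀ x ∈ I, ∀ y ∈ I, ¬ G.Adj x y) ∧ B.card ≤ ∑ y ∈ I, (degIn G y B + 1) := by
  obtain ⟨I, hI, hmax⟩ := exists_max_image
    (B.powerset.filter fun I => ∀ x ∈ I, ∀ y ∈ I, ¬ G.Adj x y) card ⟨∅, by simp⟩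
  simp only [mem_filter, mem_powerset] at hI hmax
  refine ⟨I, hI.1, hI.2, ?_⟩
  have hcover : B ⊆ I.biUnion fun y => insert y (B.filter (G.Adj y)) := by
    intro v hv
    by_contra hcon
    simp only [mem_biUnion, mem_insert, mem_filter, not_exists, not_and, not_or] at hcon
    have hvI : v ∉ I := fun h => (hcon v h).1 rfl
    have hnot : ∀ y ∈ I, ¬ G.Adj y v := fun y hy => (hcon y hy).2 hv
    have := hmax (insert v I) ⟨insert_subset hv hI.1, fun x hx y hy => by
      rcases mem_insert.1 hx with hxv | hxI <;> rcases mem_insert.1 hy with hyv | hyI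
      · exact hxv ▸ hyv ▸ G.loopless.irrefl _
      · exact fun h => hnot y hyI (hxv ▸ h.symm)
      · exact hyv ▸ hnot x hxI
      · exact hI.2 x hxI y hyI⟩
    rw [card_insert_of_notMem hvI] at this
    omega
  exact (card_le_card hcover).trans
    (card_biUnion_le.trans (sum_le_sum fun y _ => card_insert_le _ _))

/-! ### Solo neighbours -/

/-- `z` is the only neighbour of `y` in the colour class of `z`. -/
def Solo (G : SimpleGraph V) (S : Finset V) (f : V → κ) (z y : V) : Prop :=
  G.Adj y z ∧ ∀ z' ∈ S, f z' = f z → G.Adj y z' → z' = z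

lemma two_le_degIn_add_card_solo (G : SimpleGraph V) {S : Finset V} {f : V → κ} {y : V} {c : κ}
    (h : ∃ w ∈ S, f w = c ∧ G.Adj y w) :
    2 ≤ degIn G y (colorClass f S c) +
      ((colorClass f S c).filter fun z => Solo G S f z y).card := by
  obtain ⟨w, hw, hwc, hyw⟩ := h
  have hmem : w ∈ (colorClass f S c).filter (G.Adj y) := by simp [hw, hwc, hyw]
  by_cases hs : Solo G S f w y
  · have h1 : 0 < degIn G y (colorClass f S c) := card_pos.2 ⟨w, hmem⟩
    have h2 : 0 < ((colorClass f S c).filter fun z => Solo G S f z y).card :=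
      card_pos.2 ⟨w, by simp [hw, hwc, hs]⟩
    omega
  · simp only [Solo, hyw, true_and, not_forall] at hs
    obtain ⟨w', hw', hww', hyw', hne⟩ := hs
    have : 1 < degIn G y (colorClass f S c) :=
      one_lt_card.2 ⟨w, hmem, w', by simp [hw', hww', hwc, hyw'], Ne.symm hne⟩
    omega

lemma card_add_card_le_degIn_add_card_solo (G : SimpleGraph V) {S : Finset V} {f : V → κ} {y : V}
    {A T : Finset κ} (hT : T ⊆ A) (h : ∀ c ∈ A, ∃ w ∈ S, f w = c ∧ G.Adj y w) :
    T.card + A.card ≤ degIn G y (S.filter fun w => f w ∈ A) +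
      ((S.filter fun z => f z ∈ T).filter fun z => Solo G S f z y).card := by
  have hsolo : ((S.filter fun z => f z ∈ T).filter fun z => Solo G S f z y).card =
      ∑ c ∈ T, ((colorClass f S c).filter fun z => Solo G S f z y).card := by
    rw [filter_comm, card_filter_mem_eq_sum]
    exact sum_congr rfl fun c _ => by rw [colorClass, colorClass, filter_comm]
  rw [hsolo, degIn_filter_mem_eq_sum, ← sum_sdiff hT, add_assoc, ← sum_add_distrib]
  have h1 : ∑ c ∈ T, 2 ≤ ∑ c ∈ T, (degIn G y (colorClass f S c) +
      ((colorClass f S c).filter fun z => Solo G S f z y).card) :=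
    sum_le_sum fun c hc => two_le_degIn_add_card_solo G (h c (hT hc))
  have h2 : ∑ c ∈ A \ T, 1 ≤ ∑ c ∈ A \ T, degIn G y (colorClass f S c) := by
    refine sum_le_sum fun c hc => ?_
    obtain ⟨w, hw, hwc, hyw⟩ := h c (mem_sdiff.1 hc).1
    exact card_pos.2 ⟨w, by simp [hw, hwc, hyw]⟩
  have h3 := card_sdiff_add_card_eq_card hT
  simp only [sum_const, smul_eq_mul] at h1 h2
  omega

lemma lt_of_solo_degIn_le (G : SimpleGraph V) {W B : Finset V} {q t : ℕ} {r : V → V → Prop}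
    (hr : ∀ z y, r z y → G.Adj z y) (hB : B.card = q * W.card + 1)
    (hy : ∀ y ∈ B, 2 ≤ degIn G y W + (W.filter fun z => r z y).card)
    (hz : ∀ z ∈ W, degIn G z B ≤ q + t)
    (hsolo : ∀ z ∈ W, ∀ y ∈ B, r z y → degIn G z B ≤ q) : q < t := by
  by_contra! htq
  have h1 : ∑ y ∈ B, 2 ≤ ∑ y ∈ B, (degIn G y W + (W.filter fun z => r z y).card) :=
    sum_le_sum hy
  have h2 : ∑ y ∈ B, (W.filter fun z => r z y).card = ∑ z ∈ W, (B.filter fun y => r z y).card := by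
    simp only [card_filter]
    exact sum_comm
  rw [sum_add_distrib, h2, sum_degIn_comm, ← sum_add_distrib] at h1
  have h3 : ∑ z ∈ W, (degIn G z B + (B.filter fun y => r z y).card) ≤ ∑ z ∈ W, 2 * q := by
    refine sum_le_sum fun z hzW => ?_
    by_cases hex : ∃ y ∈ B, r z y
    · obtain ⟨y, hyB, hzy⟩ := hex
      have h4 := hsolo z hzW y hyB hzy
      have h5 : (B.filter fun y => r z y).card ≤ degIn G z B :=
        card_le_card (monotone_filter_right _ fun y _ => hr z y)
      omega
    · push Not at hex
      rw [filter_false_of_mem hex, card_empty]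
      have := hz z hzW
      omega
  simp only [sum_const, smul_eq_mul] at h1 h3
  rw [hB] at h1
  nlinarith

lemma exists_nonadj_of_card_solo (G : SimpleGraph V) {A B : Finset V} {q s t : ℕ}
    {r : V → V → Prop} (hB : B.card = q * s + 1) (hA : A.card = t * s) (hqt : q ≤ t)
    (hdeg : ∀ y ∈ B, degIn G y B + 1 ≤ q)
    (hsolo : ∀ y ∈ B, t + degIn G y B + 1 ≤ q + (A.filter fun z => r z y).card) :
    ∃ z ∈ A, ∃ y₁ ∈ B, ∃ y₂ ∈ B, y₁ ≠ y₂ ∧ r z y₁ ∧ r z y₂ ∧ ¬ G.Adj y₁ y₂ := by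
  obtain ⟨I, hIB, hI, hdom⟩ := exists_independent G B
  have h1 : ∑ y ∈ I, (degIn G y B + 1) ≤ ∑ y ∈ I, q := sum_le_sum fun y hy => hdeg y (hIB hy)
  have h2 : ∑ y ∈ I, (t + (degIn G y B + 1)) ≤ ∑ y ∈ I, (q + (A.filter fun z => r z y).card) :=
    sum_le_sum fun y hy => hsolo y (hIB hy)
  have h3 : ∑ y ∈ I, (A.filter fun z => r z y).card = ∑ z ∈ A, (I.filter fun y => r z y).card := by
    simp only [card_filter]
    exact sum_comm
  rw [sum_add_distrib, sum_add_distrib (f := fun _ => q), h3] at h2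
  simp only [sum_const, smul_eq_mul] at h1 h2
  have hsI : s < I.card := by
    by_contra! h
    have := Nat.mul_le_mul_right q h
    rw [mul_comm s q] at this
    omega
  have hlt : ∑ z ∈ A, 1 < ∑ z ∈ A, (I.filter fun y => r z y).card := by
    simp only [sum_const, smul_eq_mul, mul_one, hA]
    obtain ⟨e, rfl⟩ := Nat.exists_eq_add_of_le hqt
    have := Nat.mul_le_mul_right e hsI.le
    nlinarith
  obtain ⟨z, hz, hzI⟩ := exists_lt_of_sum_lt hlt
  obtain ⟨y₁, hy₁, y₂, hy₂, hne⟩ := one_lt_card.1 hzI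
  rw [mem_filter] at hy₁ hy₂
  exact ⟨z, hz, y₁, hIB hy₁.1, y₂, hIB hy₂.1, hne, hy₁.2, hy₂.2, hI _ hy₁.1 _ hy₂.1⟩

/-! ### Recolouring -/

/-- The colours from which `a` is reachable by moving vertices. -/
def accessible [Fintype κ] (G : SimpleGraph V) (S : Finset V) (f : V → κ) (a : κ) : Finset κ :=
  univ.filter fun c => ReflTransGen (Movable G S f) c a

lemma mem_accessible [Fintype κ] {G : SimpleGraph V} {S : Finset V} {f : V → κ} {a c : κ} :
    c ∈ accessible G S f a ↔ ReflTransGen (Movable G S f) c a := by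
  simp [accessible]

lemma reachIn_accessible [Fintype κ] {G : SimpleGraph V} {S : Finset V} {f : V → κ} {a c : κ}
    (hc : c ∈ accessible G S f a) : ReachIn (Movable G S f) (accessible G S f a) c a := by
  rw [mem_accessible] at hc
  induction hc using ReflTransGen.head_induction_on with
  | refl => exact .refl
  | head hxy hy ih =>
    exact ih.head hxy (mem_accessible.2 (hy.head hxy)) (mem_accessible.2 hy)

lemma exists_adj_of_notMem_accessible [Fintype κ] {G : SimpleGraph V} {S : Finset V} {f : V → κ}
    {a c : κ} {v : V} (hv : v ∈ S) (hva : f v ∉ accessible G S f a)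
    (hc : c ∈ accessible G S f a) : ∃ w ∈ S, f w = c ∧ G.Adj v w := by
  by_contra! hcon
  exact hva (mem_accessible.2 ((mem_accessible.1 hc).head ⟨v, hv, rfl, hcon⟩))

/-- Replace the colouring outside the colours `A`, leaving out one vertex `y`. -/
lemma exists_recolor {G : SimpleGraph V} {S : Finset V} {C A : Finset κ} {f g : V → κ} {s : ℕ}
    {a b : κ} {y : V} (hf : Proper G S f)
    (hcard : ∀ x, (colorClass f S x).card + (if x = a then 1 else 0) =
      (if x ∈ C then s else 0) + (if x = b then 1 else 0))
    (ha : a ∈ A) (hb : b ∉ A) (hyA : f y ∉ A)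
    (hg : Proper G ((S.filter fun v => f v ∉ A).erase y) g)
    (hgcard : ∀ x, (colorClass g ((S.filter fun v => f v ∉ A).erase y) x).card =
      if x ∈ C \ A then s else 0) :
    ∃ h : V → κ, Proper G (S.erase y) h ∧ (∀ v, f v ∈ A → h v = f v) ∧
      (∀ v ∈ S.erase y, f v ∉ A → h v ∈ C \ A) ∧
      ∀ x, (colorClass h (S.erase y) x).card + (if x = a then 1 else 0) =
        if x ∈ C then s else 0 := by
  have hgC : ∀ v ∈ S.erase y, f v ∉ A → g v ∈ C \ A := by
    intro v hv hvA
    by_contra hcon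
    have h := hgcard (g v)
    rw [if_neg hcon, card_eq_zero] at h
    have hmem : v ∈ colorClass g ((S.filter fun v => f v ∉ A).erase y) (g v) := by
      simp only [mem_erase] at hv
      simp [hv, hvA]
    rw [h] at hmem
    exact notMem_empty _ hmem
  have hgB : ∀ v ∈ S.erase y, f v ∉ A → v ∈ (S.filter fun v => f v ∉ A).erase y := by
    intro v hv hvA
    simp only [mem_erase] at hv
    simp [hv, hvA]
  refine ⟨fun v => if f v ∈ A then f v else g v, ?_, ?_, ?_, ?_⟩
  · intro v hv w hw hvw
    by_cases hvA : f v ∈ A <;> by_cases hwA : f w ∈ A <;> simp only [hvA, hwA, if_true, if_false]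
    · exact hf v (mem_of_mem_erase hv) w (mem_of_mem_erase hw) hvw
    · exact fun h => (mem_sdiff.1 (hgC w hw hwA)).2 (h ▸ hvA)
    · exact fun h => (mem_sdiff.1 (hgC v hv hvA)).2 (h ▸ hwA)
    · exact hg v (hgB v hv hvA) w (hgB w hw hwA) hvw
  · intro v hv
    simp [hv]
  · intro v hv hvA
    simpa only [hvA, if_false] using hgC v hv hvA
  · intro x
    by_cases hxA : x ∈ A
    · have hxb : x ≠ b := fun h => hb (h ▸ hxA)
      have h := hcard x
      rw [if_neg hxb, add_zero] at h
      rw [← h]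
      congr 2
      ext v
      simp only [mem_colorClass, mem_erase]
      constructor
      · rintro ⟨⟨hvy, hvS⟩, hvx⟩
        refine ⟨hvS, ?_⟩
        by_cases hvA : f v ∈ A
        · simpa only [hvA, if_true] using hvx
        · simp only [hvA, if_false] at hvx
          exact absurd (hvx ▸ hxA) (mem_sdiff.1 (hgC v (mem_erase.2 ⟨hvy, hvS⟩) hvA)).2
      · rintro ⟨hvS, rfl⟩
        exact ⟨⟨fun h => hyA (h ▸ hxA), hvS⟩, by simp [hxA]⟩
    · have hxa : x ≠ a := fun h => hxA (h ▸ ha)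
      have h := hgcard x
      simp only [mem_sdiff, hxA, not_false_eq_true, and_true] at h
      rw [if_neg hxa, add_zero, ← h]
      congr 1
      ext v
      simp only [mem_colorClass, mem_erase, mem_filter]
      constructor
      · rintro ⟨⟨hvy, hvS⟩, hvx⟩
        have hvA : f v ∉ A := by
          intro hvA
          simp only [hvA, if_true] at hvx
          exact hxA (hvx ▸ hvA)
        simp only [hvA, if_false] at hvx
        exact ⟨⟨hvy, hvS, hvA⟩, hvx⟩
      · rintro ⟨⟨hvy, hvS, hvA⟩, hvx⟩
        exact ⟨⟨hvy, hvS⟩, by simpa only [hvA, if_false] using hvx⟩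

/-- Move `z` to the colour `x`, which reaches the deficient colour `a`, and give `y` the old colour
of `z`. -/
lemma exists_balanced_of_movable {G : SimpleGraph V} {S : Finset V} {C P : Finset κ} {h : V → κ}
    {s : ℕ} {a x : κ} {y z : V} (hh : Proper G (S.erase y) h)
    (hcard : ∀ c, (colorClass h (S.erase y) c).card + (if c = a then 1 else 0) =
        if c ∈ C then s else 0)
    (hy : y ∈ S) (hz : z ∈ S.erase y) (haP : a ∈ P) (hzP : h z ∉ P)
    (hx : ReachIn (Movable G (S.erase y) h) P x a)
    (hzx : ∀ w ∈ S.erase y, h w = x → ¬ G.Adj z w)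
    (hyz : ∀ w ∈ S.erase y, h w = h z → G.Adj y w → w = z) :
    ∃ f : V → κ, Proper G S f ∧ ∀ c, (colorClass f S c).card = if c ∈ C then s else 0 := by
  obtain ⟨f, hf, hout, hin, hfx, hfc⟩ := exists_shift hh P haP x hx
  have hxP := hx.mem haP
  have hfz : f z = h z := hout z hzP
  refine ⟨Function.update (Function.update f z x) y (h z), Proper.update ?_ ?_, ?_⟩
  · exact (hf.mono (erase_subset _ _)).update fun w hw _ hwx => hzx w hw (hfx w hwx)
  · intro w hw hwy hwz
    have hwz' : w ≠ z := by
      rintro rfl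
      rw [Function.update_self] at hwz
      exact hzP (hwz ▸ hxP)
    rw [Function.update_of_ne hwz'] at hwz
    have hhw : h w = h z := by
      by_cases hwP : h w ∈ P
      · exact absurd (hwz ▸ hin w hwP) hzP
      · rw [← hout w hwP, hwz]
    exact fun hyw => hwz' (hyz w (mem_erase.2 ⟨hwy, hw⟩) hhw hyw)
  · intro c
    have h1 := card_colorClass_update (f := Function.update f z x) hy (h z) c
    have h2 := card_colorClass_update (f := f) hz x c
    have h3 := card_colorClass_erase (f := f) hz c
    have h4 := hfc c
    have h5 := hcard c
    rw [hfz] at h3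
    omega

/-- A colouring whose class sizes are right except for one missing vertex in colour `a` and one
extra vertex in colour `b` can be turned into a balanced one, provided that balanced colourings
exist for smaller sets of colours. -/
lemma exists_balanced_of_nearly [Fintype κ] {G : SimpleGraph V} {S : Finset V} {C : Finset κ}
    {s : ℕ} (hdeg : ∀ v ∈ S, degIn G v S < C.card)
    (ih : ∀ (S' : Finset V) (C' : Finset κ), C'.card < C.card → S'.card = C'.card * s →
      (∀ v ∈ S', degIn G v S' < C'.card) →
      ∃ g : V → κ, Proper G S' g ∧ ∀ x, (colorClass g S' x).card = if x ∈ C' then s else 0)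
    {f : V → κ} {a b : κ} (ha : a ∈ C) (hb : b ∈ C) (hf : Proper G S f)
    (hcard : ∀ x, (colorClass f S x).card + (if x = a then 1 else 0) =
      (if x ∈ C then s else 0) + (if x = b then 1 else 0)) :
    ∃ f' : V → κ, Proper G S f' ∧ ∀ x, (colorClass f' S x).card = if x ∈ C then s else 0 := by
  induction hn : Fintype.card κ - (accessible G S f a).card using Nat.strong_induction_on
    generalizing f b with
  | _ n IH =>
  subst hn
  set A := accessible G S f a
  have haA : a ∈ A := mem_accessible.2 .refl
  have hreach : ∀ c ∈ A, ReachIn (Movable G S f) A c a := fun c hc => reachIn_accessible hc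
  by_cases hbA : b ∈ A
  · obtain ⟨f', hf', -, -, -, hf'card⟩ := exists_shift hf A haA b (hreach b hbA)
    refine ⟨f', hf', fun x => ?_⟩
    have h1 := hf'card x
    have h2 := hcard x
    omega
  have hab : a ≠ b := fun h => hbA (h ▸ haA)
  have hfC : ∀ v ∈ S, f v ∈ C := by
    intro v hv
    by_contra hvC
    have h := hcard (f v)
    rw [if_neg hvC, if_neg (fun h : f v = b => hvC (h ▸ hb))] at h
    have : 0 < (colorClass f S (f v)).card := card_pos.2 ⟨v, by simp [hv]⟩
    omega
  have hAC : A ⊆ C := by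
    intro c hc
    rcases ReflTransGen.cases_head (mem_accessible.1 hc) with rfl | ⟨d, ⟨v, hv, hvc, -⟩, -⟩
    · exact ha
    · exact hvc ▸ hfC v hv
  set B := S.filter fun v => f v ∉ A
  have hBS : B ⊆ S := filter_subset _ _
  have memB : ∀ v, v ∈ B ↔ v ∈ S ∧ f v ∉ A := fun v => by simp [B]
  set q := (C \ A).card
  have hqk : q + A.card = C.card := card_sdiff_add_card_eq_card hAC
  have hBcard : B.card = q * s + 1 := by
    have hB' : B = S.filter fun v => f v ∈ C \ A := by
      ext v
      simp only [memB, mem_filter, mem_sdiff]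
      exact ⟨fun h => ⟨h.1, hfC v h.1, h.2⟩, fun h => ⟨h.1, h.2.2⟩⟩
    have hsum : ∀ c ∈ C \ A, (colorClass f S c).card = s + (if c = b then 1 else 0) := by
      intro c hc
      rw [mem_sdiff] at hc
      have h := hcard c
      rwa [if_neg (fun h : c = a => hc.2 (h ▸ haA)), if_pos hc.1] at h
    rw [hB', card_filter_mem_eq_sum, sum_congr rfl hsum, sum_add_distrib, sum_const, smul_eq_mul,
      sum_ite_eq', if_pos (mem_sdiff.2 ⟨hb, hbA⟩)]
  have hadj : ∀ y ∈ B, ∀ c ∈ A, ∃ w ∈ S, f w = c ∧ G.Adj y w := fun y hy c hc =>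
    exists_adj_of_notMem_accessible ((memB y).1 hy).1 ((memB y).1 hy).2 hc
  have hsplit : ∀ v ∈ S, ∀ D ⊆ A,
      degIn G v (S.filter fun w => f w ∈ D) + degIn G v B < C.card := by
    intro v hv D hD
    refine (degIn_add_le G v (filter_subset _ _) hBS ?_).trans_lt (hdeg v hv)
    rw [disjoint_left]
    intro w hw hwB
    exact ((memB w).1 hwB).2 (hD (mem_filter.1 hw).2)
  have hBdeg : ∀ y ∈ B, degIn G y B + 1 ≤ q := by
    intro y hy
    have h1 := card_le_degIn G (hadj y hy)
    have h2 := hsplit y (hBS hy) A Subset.rfl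
    omega
  have hqC : q < C.card := by
    have : 0 < A.card := card_pos.2 ⟨a, haA⟩
    omega
  have hrecolor : ∀ y ∈ B, ∃ h : V → κ, Proper G (S.erase y) h ∧ (∀ v, f v ∈ A → h v = f v) ∧
      (∀ v ∈ S.erase y, f v ∉ A → h v ∈ C \ A) ∧
      ∀ x, (colorClass h (S.erase y) x).card + (if x = a then 1 else 0) =
        if x ∈ C then s else 0 := by
    intro y hy
    obtain ⟨g, hg, hgcard⟩ := ih (B.erase y) (C \ A) hqC
      (by rw [card_erase_of_mem hy, hBcard, Nat.add_sub_cancel])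
      (fun v hv => (Nat.lt_of_lt_of_le (Nat.lt_succ_of_le (degIn_mono G v (erase_subset _ _)))
        (hBdeg v (mem_of_mem_erase hv))))
    exact exists_recolor hf hcard haA hbA ((memB y).1 hy).2 hg hgcard
  have hs : (colorClass f S a).card + 1 = s := by
    have h := hcard a
    rwa [if_pos rfl, if_pos ha, if_neg hab, add_zero] at h
  have hclass : ∀ c ∈ A, c ≠ a → (colorClass f S c).card = s := by
    intro c hc hca
    have h := hcard c
    rwa [if_neg hca, if_pos (hAC hc), if_neg (fun h : c = b => hbA (h ▸ hc))] at h
  have hne : ∃ c ∈ A, c ≠ a := by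
    by_contra! hcon
    have hA1 : A = {a} := eq_singleton_iff_unique_mem.2 ⟨haA, hcon⟩
    have h1 : ∑ y ∈ B, 1 ≤ ∑ y ∈ B, degIn G y (colorClass f S a) := by
      refine sum_le_sum fun y hy => ?_
      obtain ⟨w, hw, hwa, hyw⟩ := hadj y hy a haA
      exact card_pos.2 ⟨w, by simp [hw, hwa, hyw]⟩
    have h2 : ∑ v ∈ colorClass f S a, degIn G v B ≤ ∑ v ∈ colorClass f S a, q := by
      refine sum_le_sum fun v hv => ?_
      have h3 := (degIn_mono G v hBS).trans_lt (hdeg v (mem_colorClass.1 hv).1)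
      rw [hA1, card_singleton] at hqk
      omega
    rw [sum_degIn_comm] at h1
    simp only [sum_const, smul_eq_mul, mul_one] at h1 h2
    rw [hBcard, ← hs] at h1
    nlinarith
  obtain ⟨u, huA, T, hTA, hT, haT, huT, hTout, hterm⟩ := exists_terminal_family haA hreach hne
  have hTcard : (S.filter fun v => f v ∈ T).card = T.card * s := by
    rw [card_filter_mem_eq_sum, sum_const_nat]
    exact fun c hc => hclass c (hTA hc) (fun h => haT (h ▸ hc))
  have transfer : ∀ y ∈ B, ∀ h : V → κ, (∀ v, f v ∈ A → h v = f v) →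
      (∀ v ∈ S.erase y, f v ∉ A → h v ∈ C \ A) → ∀ v ∈ S.erase y, ∀ c ∈ A,
      (h v = c ↔ f v = c) := by
    intro y hy h hin hout v hv c hc
    by_cases hvA : f v ∈ A
    · rw [hin v hvA]
    · exact ⟨fun hvc => absurd (hvc ▸ hc) (mem_sdiff.1 (hout v hv hvA)).2,
        fun hvc => absurd (hvc ▸ hc) hvA⟩
  by_cases hmov : ∃ z ∈ S, f z ∈ T ∧ ∃ y ∈ B, Solo G S f z y ∧
      ∃ x ∈ A, x ≠ f z ∧ ∀ w ∈ S, f w = x → ¬ G.Adj z w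
  · obtain ⟨z, hzS, hzT, y, hyB, hsolo, x, hxA, hxz, hzx⟩ := hmov
    obtain ⟨h, hh, hin, hout, hhcard⟩ := hrecolor y hyB
    have htr := transfer y hyB h hin hout
    have hzA := hTA hzT
    have hyA := ((memB y).1 hyB).2
    have hzy : z ∈ S.erase y := mem_erase.2 ⟨fun e => hyA (e ▸ hzA), hzS⟩
    have hhz : h z = f z := hin z hzA
    have haz : a ≠ f z := fun e => haT (e ▸ hzT)
    refine exists_balanced_of_movable (P := A.erase (f z)) (x := x) hh hhcard (hBS hyB) hzy
      (mem_erase.2 ⟨haz, haA⟩) (by simp [hhz]) ?_ ?_ ?_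
    · refine ReflTransGen.mono ?_ _ _ (hterm _ hzT x hxA hxz)
      rintro c d ⟨⟨v, hv, hvc, hvd⟩, hc, hd⟩
      have hcA := mem_of_mem_erase hc
      have hvy : v ∈ S.erase y := mem_erase.2 ⟨fun e => hyA (e ▸ hvc ▸ hcA), hv⟩
      exact ⟨⟨v, hvy, (htr v hvy c hcA).2 hvc, fun w hw hwd =>
        hvd w (mem_of_mem_erase hw) ((htr w hw d (mem_of_mem_erase hd)).1 hwd)⟩, hc, hd⟩
    · exact fun w hw hwx => hzx w (mem_of_mem_erase hw) ((htr w hw x hxA).1 hwx)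
    · intro w hw hwz
      exact hsolo.2 w (mem_of_mem_erase hw) ((htr w hw _ hzA).1 (hwz.trans hhz))
  push Not at hmov
  have hsolodeg : ∀ z ∈ S, f z ∈ T → ∀ y ∈ B, Solo G S f z y → degIn G z B ≤ q := by
    intro z hz hzT y hy hsolo
    have h1 := card_le_degIn G (D := A.erase (f z)) (v := z) (S := S) (f := f) fun c hc =>
      hmov z hz hzT y hy hsolo c (mem_of_mem_erase hc) (ne_of_mem_erase hc)
    have h2 := hsplit z hz (A.erase (f z)) (erase_subset _ _)
    have h3 := card_erase_add_one (hTA hzT)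
    omega
  have hTdeg : ∀ z ∈ S, f z ∈ T → degIn G z B ≤ q + T.card := by
    intro z hz hzT
    have h1 := card_le_degIn G (D := (A \ T).erase u) (v := z) (S := S) (f := f) fun c hc => by
      by_contra! hcon
      obtain ⟨hcu, hcA, hcT⟩ : c ≠ u ∧ c ∈ A ∧ c ∉ T := by simpa using hc
      rcases hTout (f z) hzT c hcA ⟨z, hz, rfl, hcon⟩ with h | h
      exacts [hcu h, hcT h]
    have h2 := hsplit z hz ((A \ T).erase u) ((erase_subset _ _).trans sdiff_subset)
    have h3 := card_erase_add_one (mem_sdiff.2 ⟨huA, huT⟩)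
    have h4 := card_sdiff_add_card_eq_card hTA
    omega
  have hqT : q < T.card := by
    obtain ⟨w, hw⟩ := hT
    have hws := hclass w (hTA hw) (fun h => haT (h ▸ hw))
    refine lt_of_solo_degIn_le G (W := colorClass f S w) (B := B)
      (r := fun z y => Solo G S f z y) (fun z y h => h.1.symm) (by rw [hws, hBcard]) ?_ ?_ ?_
    · exact fun y hy => two_le_degIn_add_card_solo G (hadj y hy w (hTA hw))
    · intro z hz
      rw [mem_colorClass] at hz
      exact hTdeg z hz.1 (hz.2 ▸ hw)
    · intro z hz
      rw [mem_colorClass] at hz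
      exact hsolodeg z hz.1 (hz.2 ▸ hw)
  obtain ⟨z, hz, y₁, hy₁, y₂, hy₂, hy₁₂, hsolo₁, hsolo₂, hnadj⟩ :=
    exists_nonadj_of_card_solo G (r := fun z y => Solo G S f z y) hBcard hTcard hqT.le hBdeg (by
      intro y hy
      have h1 := card_add_card_le_degIn_add_card_solo G hTA (hadj y hy)
      have h2 := hsplit y (hBS hy) A Subset.rfl
      omega)
  obtain ⟨hzS, hzT⟩ := mem_filter.1 hz
  have hzA := hTA hzT
  have hzmov := hmov z hzS hzT y₁ hy₁ hsolo₁
  obtain ⟨h, hh, hin, hout, hhcard⟩ := hrecolor y₁ hy₁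
  have htr := transfer y₁ hy₁ h hin hout
  have hy₁A := ((memB y₁).1 hy₁).2
  have hy₂A := ((memB y₂).1 hy₂).2
  have hzy₁ : z ≠ y₁ := fun e => hy₁A (e ▸ hzA)
  have hzy₂ : y₂ ≠ z := fun e => hy₂A (e ▸ hzA)
  have hzmem : z ∈ S.erase y₁ := mem_erase.2 ⟨hzy₁, hzS⟩
  have hhz : h z = f z := hin z hzA
  obtain ⟨d, hd, hzd⟩ : ∃ d ∈ C \ A, ∀ w ∈ B.erase y₁, h w = d → ¬ G.Adj z w := by
    refine exists_color_of_degIn_lt G ?_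
    refine Nat.lt_of_lt_of_le ?_ (hsolodeg z hzS hzT y₁ hy₁ hsolo₁)
    refine card_lt_card ((ssubset_iff_of_subset
      (filter_subset_filter _ (erase_subset _ _))).2 ⟨y₁, ?_, ?_⟩)
    · simp [hy₁, hsolo₁.1.symm]
    · simp
  rw [mem_sdiff] at hd
  set f' := Function.update (Function.update h z d) y₁ (f z) with hf'def
  have hf'y₁ : f' y₁ = f z := Function.update_self ..
  have hf'z : f' z = d := by
    rw [hf'def, Function.update_of_ne hzy₁, Function.update_self]
  have hf'of : ∀ v, v ≠ y₁ → v ≠ z → f' v = h v := fun v h1 h2 => by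
    rw [hf'def, Function.update_of_ne h1, Function.update_of_ne h2]
  have hf'A : ∀ v, f v ∈ A → v ≠ z → f' v = f v := fun v hv hvz => by
    rw [hf'of v (fun e => hy₁A (e ▸ hv)) hvz, hin v hv]
  have hf'inv : ∀ v ∈ S, v ≠ y₁ → f' v ∈ A → f v = f' v ∧ v ≠ z := by
    intro v hv hvy hvA
    have hvz : v ≠ z := by
      rintro rfl
      exact hd.2 (hf'z ▸ hvA)
    rw [hf'of v hvy hvz] at hvA ⊢
    exact ⟨(htr v (mem_erase.2 ⟨hvy, hv⟩) _ hvA).1 rfl, hvz⟩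
  have hf'proper : Proper G S f' := by
    refine Proper.update ((hh.mono (erase_subset _ _)).update ?_) ?_
    · intro w hw hwz hwd
      refine hzd w (mem_erase.2 ⟨ne_of_mem_erase hw, (memB w).2 ⟨mem_of_mem_erase hw, ?_⟩⟩) hwd
      intro hwA
      exact hd.2 (hwd ▸ hin w hwA ▸ hwA)
    · intro w hw hwy hwz hadjw
      have hww : f' w = f z := by rw [hf'def, Function.update_of_ne hwy, hwz]
      obtain ⟨h1, h2⟩ := hf'inv w hw hwy (hww ▸ hzA)
      exact h2 (hsolo₁.2 w hw (h1.trans hww) hadjw)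
  have hf'card : ∀ x, (colorClass f' S x).card + (if x = a then 1 else 0) =
      (if x ∈ C then s else 0) + (if x = d then 1 else 0) := by
    intro x
    have h1 := card_colorClass_update (f := Function.update h z d) (hBS hy₁) (f z) x
    have h2 := card_colorClass_update (f := h) hzmem d x
    have h3 := card_colorClass_erase (f := h) hzmem x
    have h4 := hhcard x
    rw [hhz] at h3
    rw [← hf'def] at h1
    omega
  have hacc : ∀ c, ReachIn (Movable G S f) (A.erase (f z)) c a → c ∈ accessible G S f' a := by
    intro c hc
    refine mem_accessible.2 (ReflTransGen.mono ?_ _ _ hc)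
    rintro x x' ⟨⟨v, hv, hvx, hvx'⟩, hx, hx'⟩
    rw [mem_erase] at hx hx'
    refine ⟨v, hv, ?_, fun w hw hwx' => ?_⟩
    · rw [hf'A v (hvx ▸ hx.2) (fun e => hx.1 (e ▸ hvx.symm)), hvx]
    · have hwy : w ≠ y₁ := fun e => hx'.1 (by rw [← hwx', e, hf'y₁])
      exact hvx' w hw ((hf'inv w hw hwy (hwx' ▸ hx'.2)).1.trans hwx')
  have haz : f z ≠ a := fun e => haT (e ▸ hzT)
  have hWacc : f z ∈ accessible G S f' a := by
    obtain ⟨x, hx, ⟨v, hv, hvz, hvx⟩, hxa⟩ := (hreach _ hzA).exists_step haA haz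
    rw [mem_erase] at hx
    refine mem_accessible.2 ((mem_accessible.1 (hacc x hxa)).head ⟨v, hv, ?_, fun w hw hwx => ?_⟩)
    · rw [hf'A v (hvz ▸ hzA) ?_, hvz]
      rintro rfl
      obtain ⟨w, hw, hwx, hvw⟩ := hzmov x hx.2 hx.1
      exact hvx w hw hwx hvw
    · have hwy : w ≠ y₁ := fun e => hx.1 (by rw [← hwx, e, hf'y₁])
      exact hvx w hw ((hf'inv w hw hwy (hwx ▸ hx.2)).1.trans hwx)
  have hy₂acc : f' y₂ ∈ accessible G S f' a := by
    refine mem_accessible.2 ((mem_accessible.1 hWacc).head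
      ⟨y₂, hBS hy₂, rfl, fun w hw hwz hadjw => ?_⟩)
    by_cases hwy : w = y₁
    · exact hnadj (hwy ▸ hadjw.symm)
    · obtain ⟨h1, h2⟩ := hf'inv w hw hwy (hwz ▸ hzA)
      exact h2 (hsolo₂.2 w hw (h1.trans hwz) hadjw)
  have hss : A ⊂ accessible G S f' a := by
    refine (ssubset_iff_of_subset fun c hc => ?_).2 ⟨f' y₂, hy₂acc, ?_⟩
    · by_cases hcz : c = f z
      · exact hcz ▸ hWacc
      · exact hacc c (hterm _ hzT c hc hcz)
    · rw [hf'of y₂ hy₁₂.symm hzy₂]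
      exact (mem_sdiff.1 (hout y₂ (mem_erase.2 ⟨hy₁₂.symm, hBS hy₂⟩) hy₂A)).2
  refine IH _ ?_ hd.1 hf'proper hf'card rfl
  have h1 := card_lt_card hss
  have h2 := card_le_univ (accessible G S f' a)
  omega

/-- The edges of `G` with both ends in `T`. -/
def edgesWithin (G : SimpleGraph V) (T : Finset V) : SimpleGraph V where
  Adj x y := G.Adj x y ∧ x ∈ T ∧ y ∈ T
  symm := ⟨fun _ _ h => ⟨h.1.symm, h.2.2, h.2.1⟩⟩
  loopless := ⟨fun _ h => h.1.ne rfl⟩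

lemma exists_balanced_partition (C : Finset κ) (s : ℕ) [Nonempty κ] (S : Finset V)
    (hS : S.card = C.card * s) :
    ∃ f : V → κ, ∀ x, (colorClass f S x).card = if x ∈ C then s else 0 := by
  induction C using Finset.induction_on generalizing S with
  | empty =>
    obtain rfl : S = ∅ := by simpa using hS
    exact ⟨fun _ => Classical.arbitrary κ, fun x => by simp [colorClass]⟩
  | insert c C hc ih =>
    rw [card_insert_of_notMem hc, add_mul, one_mul] at hS
    obtain ⟨R, hRS, hR⟩ := exists_subset_card_eq (show s ≤ S.card by omega)
    obtain ⟨f, hf⟩ := ih (S \ R) (by rw [card_sdiff_of_subset hRS]; omega)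
    refine ⟨fun v => if v ∈ R then c else f v, fun x => ?_⟩
    have hx := hf x
    by_cases hxc : x = c
    · subst hxc
      rw [if_neg hc, card_eq_zero] at hx
      rw [if_pos (mem_insert_self _ _), ← hR]
      congr 1
      ext v
      rw [mem_colorClass]
      by_cases hv : v ∈ R
      · simp [hv, hRS hv]
      · simp only [hv, if_false, iff_false, not_and]
        intro hvS hvx
        have : v ∈ colorClass f (S \ R) x := by simp [hvS, hv, hvx]
        rw [hx] at this
        exact notMem_empty _ this
    · simp only [mem_insert, hxc, false_or]
      rw [← hx]
      congr 1
      ext v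
      by_cases hv : v ∈ R <;> simp [hv, Ne.symm hxc]

/-- **Hajnal–Szemerédi theorem.** -/
theorem exists_balanced [Fintype κ] [Nonempty κ] (s k : ℕ) (G : SimpleGraph V) (S : Finset V)
    (C : Finset κ) (hk : C.card = k) (hS : S.card = C.card * s)
    (hdeg : ∀ v ∈ S, degIn G v S < C.card) :
    ∃ f : V → κ, Proper G S f ∧ ∀ x, (colorClass f S x).card = if x ∈ C then s else 0 := by
  induction k using Nat.strong_induction_on generalizing G S C with
  | _ k IH =>
  subst hk
  suffices h : ∀ T : Finset V, ∃ f : V → κ, Proper (edgesWithin G T) S f ∧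
      ∀ x, (colorClass f S x).card = if x ∈ C then s else 0 by
    obtain ⟨f, hf, hfc⟩ := h S
    exact ⟨f, fun v hv w hw hvw => hf v hv w hw ⟨hvw, hv, hw⟩, hfc⟩
  intro T
  induction T using Finset.induction_on with
  | empty =>
    obtain ⟨f, hf⟩ := exists_balanced_partition C s S hS
    exact ⟨f, fun v _ w _ hvw => absurd hvw.2.1 (notMem_empty _), hf⟩
  | insert u T _ ih =>
    obtain ⟨f, hf, hfc⟩ := ih
    have hdeg' : ∀ v ∈ S, degIn (edgesWithin G (insert u T)) v S < C.card := fun v hv =>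
      (card_le_card (monotone_filter_right S fun w _ hw => hw.1)).trans_lt (hdeg v hv)
    have hf' : Proper (edgesWithin G (insert u T)) (S.erase u) f := by
      intro v hv w hw hvw
      rw [mem_erase] at hv hw
      exact hf v hv.2 w hw.2 ⟨hvw.1, mem_of_mem_insert_of_ne hvw.2.1 hv.1,
        mem_of_mem_insert_of_ne hvw.2.2 hw.1⟩
    by_cases huS : u ∈ S
    · obtain ⟨d, hd, hud⟩ := exists_color_of_degIn_lt _ (f := f) (hdeg' u huS)
      have hfu : f u ∈ C := by
        by_contra h
        have h1 := hfc (f u)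
        have h2 : 0 < (colorClass f S (f u)).card := card_pos.2 ⟨u, by simp [huS]⟩
        rw [if_neg h] at h1
        omega
      refine exists_balanced_of_nearly hdeg'
        (fun S' C' hC' hS' hd' => IH _ hC' _ S' C' rfl hS' hd') hfu hd
        (hf'.update fun w hw _ => hud w hw) fun x => ?_
      have h1 := card_colorClass_update (f := f) huS d x
      have h2 := card_colorClass_erase (f := f) huS x
      have h3 := hfc x
      omega
    · rw [erase_eq_of_notMem huS] at hf'
      exact ⟨f, hf', hfc⟩

end

end HajnalSzemeredi

/-- **Hajnal–Szemerédi Theorem, complementary form (Erdős' conjecture).**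
If `H` is a graph on `n = k * m` vertices with minimum degree `δ(H) ≥ n * (1 - 1/m)`,
then `V(H)` can be partitioned into `k` sets, each of size `m`, each inducing a clique. -/
theorem erdos_clique_partition {V : Type*} [Fintype V] (H : SimpleGraph V)
    [DecidableRel H.Adj] (k m : ℕ) (hk : 0 < k) (hm : 0 < m)
    (hn : Fintype.card V = k * m)
    (hδ : (Fintype.card V : ℚ) * (1 - 1 / (m : ℚ)) ≤ (H.minDegree : ℚ)) :
    ∃ f : V → Fin k, ∀ c : Fin k,
      (Finset.univ.filter fun v => f v = c).card = m ∧
      H.IsClique {v : V | f v = c} := by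
  classical
  have : Nonempty (Fin k) := ⟨⟨0, hk⟩⟩
  have hmin : k * m ≤ H.minDegree + k := by
    have hm' : (m : ℚ) ≠ 0 := by positivity
    have heq : (Fintype.card V : ℚ) * (1 - 1 / (m : ℚ)) = k * m - k := by
      rw [hn]
      push_cast
      field_simp
    rw [heq] at hδ
    have : (k : ℚ) * m ≤ H.minDegree + k := by linarith
    exact_mod_cast this
  obtain ⟨f, hf, hcard⟩ := HajnalSzemeredi.exists_balanced (κ := Fin k) m k Hᶜ Finset.univ
    Finset.univ (by simp) (by simp [hn]) (by
      intro v _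
      have h1 : HajnalSzemeredi.degIn Hᶜ v Finset.univ = Hᶜ.degree v := by
        rw [HajnalSzemeredi.degIn, ← SimpleGraph.card_neighborFinset_eq_degree,
          SimpleGraph.neighborFinset_eq_filter]
        congr
      have h2 := H.degree_compl v
      have h3 := H.minDegree_le_degree v
      have h4 : H.degree v < Fintype.card V := H.degree_lt_card_verts v
      rw [h1, Finset.card_univ, Fintype.card_fin]
      omega)
  refine ⟨f, fun c => ⟨?_, ?_⟩⟩
  · have := hcard c
    rw [if_pos (Finset.mem_univ c)] at this
    rw [← this, HajnalSzemeredi.colorClass]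
    congr
  · intro v hv w hw hvw
    by_contra hadj
    exact hf v (Finset.mem_univ v) w (Finset.mem_univ w) (by simp [hvw, hadj]) (hv.trans hw.symm)
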